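/- arXiv:1411.3887 — 2 statements merged into one kernel-verified Lean document; each statement's English description precedes it below -/
import Mathlib

section
/- There is a constant c > 0 such that for all sufficiently large integers m and d, for every deterministic online algorithm A for vector scheduling on m unrelated machines with d dimensions, there exists a finite sequence σ of jobs such that some assignment of the jobs of σ to the machines has load at most 1 on every machine in every dimension, yet the assignment produced by A on σ has some machine whose load in some dimension is at least c · (log m + log d). -/
open scoped ENNReal

/-- Unrelated machines: load of machine `i` in dimension `k` when the jobs of `σ`
(each an `m × d` matrix of extended-nonnegative loads, `p j i k` being the load
job `j` places on machine `i` in dimension `k`) are assigned via `f`. -/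
noncomputable def unrelLoad {m d : ℕ} (σ : List (Fin m → Fin d → ℝ≥0∞))
    (f : Fin σ.length → Fin m) (i : Fin m) (k : Fin d) : ℝ≥0∞ :=
  ∑ j : Fin σ.length, if f j = i then σ.get j i k else 0

/-- The assignment produced by a deterministic online algorithm `A` on the job
sequence `σ`: the `j`-th job is assigned to the machine output by `A` on the
prefix of `σ` ending with that job. -/
def unrelOnline {m d : ℕ} (A : List (Fin m → Fin d → ℝ≥0∞) → Fin m)
    (σ : List (Fin m → Fin d → ℝ≥0∞)) : Fin σ.length → Fin m :=
  fun j => A (σ.take (j.1 + 1))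

/-- The load matrix obtained from `u` by placing the job `p` on machine `x`. -/
noncomputable def addJob {m d : ℕ} (u : Fin m → Fin d → ℝ≥0∞) (x : Fin m)
    (p : Fin m → Fin d → ℝ≥0∞) : Fin m → Fin d → ℝ≥0∞ :=
  fun i k => u i k + if x = i then p i k else 0

/-- Some job sequence makes `A` produce the loads `u`, while some offline assignment of the
same sequence has loads `v`. -/
def Reachable {m d : ℕ} (A : List (Fin m → Fin d → ℝ≥0∞) → Fin m)
    (u v : Fin m → Fin d → ℝ≥0∞) : Prop :=
  ∃ (σ : List (Fin m → Fin d → ℝ≥0∞)) (f : Fin σ.length → Fin m),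
    unrelLoad σ (unrelOnline A σ) = u ∧ unrelLoad σ f = v

lemma unrelLoad_append_singleton {m d : ℕ} (σ : List (Fin m → Fin d → ℝ≥0∞))
    (p : Fin m → Fin d → ℝ≥0∞) (g : Fin (σ ++ [p]).length → Fin m) :
    unrelLoad (σ ++ [p]) g =
      addJob (unrelLoad σ fun j => g ⟨j, by simp⟩) (g ⟨σ.length, by simp⟩) p := by
  funext i k
  have h : σ.length + 1 = (σ ++ [p]).length := by simp
  simp only [unrelLoad, addJob]
  rw [← (finCongr h).sum_comp, Fin.sum_univ_castSucc]
  congr 1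
  · refine Finset.sum_congr rfl fun j _ => ?_
    simp [finCongr, Fin.cast, List.getElem_append_left]
  · simp [finCongr, Fin.cast, Fin.last]

lemma reachable_zero {m d : ℕ} (A : List (Fin m → Fin d → ℝ≥0∞) → Fin m) :
    Reachable A 0 0 :=
  ⟨[], fun j => j.elim0, by funext i k; simp [unrelLoad], by funext i k; simp [unrelLoad]⟩

lemma Reachable.step {m d : ℕ} {A : List (Fin m → Fin d → ℝ≥0∞) → Fin m}
    {u v : Fin m → Fin d → ℝ≥0∞} (h : Reachable A u v) (p : Fin m → Fin d → ℝ≥0∞) :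
    ∃ x, ∀ y, Reachable A (addJob u x p) (addJob v y p) := by
  obtain ⟨σ, f, rfl, rfl⟩ := h
  refine ⟨A (σ ++ [p]), fun y => ⟨σ ++ [p],
    fun j => if hj : j.1 < σ.length then f ⟨j, hj⟩ else y, ?_, ?_⟩⟩
  · rw [unrelLoad_append_singleton]
    congr 1
    · congr 1
      funext j
      have hj : j.1 + 1 ≤ σ.length := j.2
      simp [unrelOnline, List.take_append_of_le_length hj]
    · simp [unrelOnline, List.take_of_length_le]
  · rw [unrelLoad_append_singleton]
    simp

/-- The tournament among the machines of `S`: two machines of equal height compete for a job,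
and the one not chosen by `A` drops out. -/
lemma exists_large_load_of_machines {m d : ℕ} {A : List (Fin m → Fin d → ℝ≥0∞) → Fin m}
    (k₀ : Fin d) {N : ℕ} (hN : 0 < N) (n : ℕ) :
    ∀ (S : Finset (Fin m)) (h : Fin m → ℕ) (u v : Fin m → Fin d → ℝ≥0∞), S.card = n →
      Reachable A u v → (∀ i ∈ S, (h i : ℝ≥0∞) ≤ u i k₀) → (∀ i ∈ S, ∀ k, v i k = 0) →
      (∀ i k, v i k ≤ 1) → N ≤ ∑ i ∈ S, 2 ^ h i →
      ∃ u' v', Reachable A u' v' ∧ (∀ i k, v' i k ≤ 1) ∧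
        ∃ i k, ∃ L : ℕ, N < 2 ^ (L + 1) ∧ (L : ℝ≥0∞) ≤ u' i k := by
  induction n with
  | zero =>
    intro S h u v hS _ _ _ _ hsum
    rw [Finset.card_eq_zero] at hS
    subst hS
    simp at hsum
    omega
  | succ n ih =>
    intro S h u v hS hR hu hv hv1 hsum
    by_cases hinj : Set.InjOn h (S : Set (Fin m))
    · obtain ⟨i, hi, hmax⟩ := S.exists_max_image h (Finset.card_pos.1 (by omega))
      refine ⟨u, v, hR, hv1, i, k₀, h i, ?_, hu i hi⟩
      refine hsum.trans_lt ?_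
      rw [← Finset.sum_image (f := fun x => 2 ^ x) hinj]
      refine Nat.geomSum_lt le_rfl fun x hx => ?_
      obtain ⟨j, hj, rfl⟩ := Finset.mem_image.1 hx
      exact Nat.lt_succ_of_le (hmax j hj)
    · simp only [Set.InjOn, not_forall] at hinj
      obtain ⟨i, hi, j, hj, hij, hne⟩ := hinj
      obtain ⟨x, hx⟩ := hR.step fun r _ => if r = i ∨ r = j then 1 else ⊤
      have key : ∀ y, x ≠ y → x ∈ S → y ∈ S → h x = h y → (x = i ∨ x = j) →
          (y = i ∨ y = j) → ∃ u' v', Reachable A u' v' ∧ (∀ i k, v' i k ≤ 1) ∧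
            ∃ i k, ∃ L : ℕ, N < 2 ^ (L + 1) ∧ (L : ℝ≥0∞) ≤ u' i k := by
        intro y hxy hxS hyS hh hxij hyij
        refine ih (S.erase y) (Function.update h x (h x + 1)) _ _ ?_ (hx y) ?_ ?_ ?_ ?_
        · rw [Finset.card_erase_of_mem hyS]; omega
        · intro r hr
          by_cases hrx : r = x
          · subst hrx
            simpa [addJob, hxij] using hu r hxS
          · simpa [addJob, hrx, Ne.symm hrx] using hu r (Finset.mem_of_mem_erase hr)
        · intro r hr k
          have hry := Finset.ne_of_mem_erase hr
          simp [addJob, Ne.symm hry, hv r (Finset.mem_of_mem_erase hr)]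
        · intro r k
          by_cases hry : y = r
          · subst hry
            simp [addJob, hyij, hv y hyS]
          · simpa [addJob, hry] using hv1 r k
        · refine hsum.trans (le_of_eq ?_)
          have hxe : x ∈ S.erase y := Finset.mem_erase.2 ⟨hxy, hxS⟩
          rw [← Finset.add_sum_erase _ _ hyS, ← Finset.add_sum_erase _ _ hxe,
            ← Finset.add_sum_erase (S.erase y) _ hxe, ← add_assoc]
          congr 1
          · simp [hh, pow_succ]; ring
          · refine Finset.sum_congr rfl fun r hr => ?_
            simp [Finset.ne_of_mem_erase hr]
      by_cases hxi : x = i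
      · subst hxi
        exact key j hne hi hj hij (.inl rfl) (.inr rfl)
      by_cases hxj : x = j
      · subst hxj
        exact key i hxi hj hi hij.symm (.inr rfl) (.inl rfl)
      refine ⟨_, _, hx i, fun r k => ?_, x, k₀, N, ?_, ?_⟩
      · by_cases hr : i = r
        · subst hr
          simp [addJob, hv i hi]
        · simpa [addJob, hr] using hv1 r k
      · exact Nat.lt_two_pow_self.trans (Nat.pow_lt_pow_right one_lt_two (Nat.lt_succ_self N))
      · simp [addJob, hxi, hxj]

/-- The game on two machines `i` and `j`: a job loads half of the live dimensions of each
machine; the loaded half stays live on the machine chosen by `A`, the other half on the other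
machine. -/
lemma exists_large_load_of_dims {m d : ℕ} {A : List (Fin m → Fin d → ℝ≥0∞) → Fin m}
    {i j : Fin m} (hij : i ≠ j) (t : ℕ) :
    ∀ (a b : Finset (Fin d)) (g h : ℕ) (u v : Fin m → Fin d → ℝ≥0∞),
      a.card = 2 ^ t → b.card = 2 ^ t → Reachable A u v →
      (∀ k ∈ a, (g : ℝ≥0∞) ≤ u i k) → (∀ k ∈ b, (h : ℝ≥0∞) ≤ u j k) →
      (∀ k ∈ a, v i k = 0) → (∀ k ∈ b, v j k = 0) → (∀ i k, v i k ≤ 1) →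
      ∃ u' v', Reachable A u' v' ∧ (∀ i k, v' i k ≤ 1) ∧
        ∃ i k, ∃ L : ℕ, g + h + t ≤ 2 * L ∧ (L : ℝ≥0∞) ≤ u' i k := by
  induction t with
  | zero =>
    intro a b g h u v ha hb hR hu hu' _ _ hv1
    obtain ⟨k, hk⟩ := Finset.card_pos.1 (by rw [ha]; simp : 0 < a.card)
    obtain ⟨l, hl⟩ := Finset.card_pos.1 (by rw [hb]; simp : 0 < b.card)
    rcases le_total g h with hgh | hgh
    · exact ⟨u, v, hR, hv1, j, l, h, by omega, hu' l hl⟩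
    · exact ⟨u, v, hR, hv1, i, k, g, by omega, hu k hk⟩
  | succ t ih =>
    intro a b g h u v ha hb hR hu hu' hv hv' hv1
    rw [pow_succ] at ha hb
    obtain ⟨s, hsa, hs⟩ := Finset.exists_subset_card_eq (by omega : 2 ^ t ≤ a.card)
    obtain ⟨r, hrb, hr⟩ := Finset.exists_subset_card_eq (by omega : 2 ^ t ≤ b.card)
    have hsc : (a \ s).card = 2 ^ t := by rw [Finset.card_sdiff_of_subset hsa]; omega
    have hrc : (b \ r).card = 2 ^ t := by rw [Finset.card_sdiff_of_subset hrb]; omega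
    obtain ⟨x, hx⟩ := hR.step fun q k =>
      if q = i then (if k ∈ s then 1 else 0) else
        if q = j then (if k ∈ r then 1 else 0) else ⊤
    have hvi : ∀ q k, addJob v i (fun q k =>
        if q = i then (if k ∈ s then 1 else 0) else
          if q = j then (if k ∈ r then 1 else 0) else ⊤) q k ≤ 1 := by
      intro q k
      by_cases hq : i = q
      · subst hq
        by_cases hk : k ∈ s
        · simp [addJob, hk, hv k (hsa hk)]
        · simpa [addJob, hk] using hv1 i k
      · simpa [addJob, hq] using hv1 q k
    have hvj : ∀ q k, addJob v j (fun q k =>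
        if q = i then (if k ∈ s then 1 else 0) else
          if q = j then (if k ∈ r then 1 else 0) else ⊤) q k ≤ 1 := by
      intro q k
      by_cases hq : j = q
      · subst hq
        by_cases hk : k ∈ r
        · simp [addJob, hij.symm, hk, hv' k (hrb hk)]
        · simpa [addJob, hij.symm, hk] using hv1 j k
      · simpa [addJob, hq] using hv1 q k
    by_cases hxi : x = i
    · subst hxi
      obtain ⟨u', v', hR', h1, i', k', L, hL, hL'⟩ :=
        ih s (b \ r) (g + 1) h _ _ hs hrc (hx j)
          (fun k hk => by simpa [addJob, hk] using hu k (hsa hk))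
          (fun k hk => by simpa [addJob, hij] using hu' k (Finset.sdiff_subset hk))
          (fun k hk => by simpa [addJob, hij.symm] using hv k (hsa hk))
          (fun k hk => by
            simpa [addJob, hij.symm, (Finset.mem_sdiff.1 hk).2]
              using hv' k (Finset.sdiff_subset hk)) hvj
      exact ⟨u', v', hR', h1, i', k', L, by omega, hL'⟩
    by_cases hxj : x = j
    · subst hxj
      obtain ⟨u', v', hR', h1, i', k', L, hL, hL'⟩ :=
        ih (a \ s) r g (h + 1) _ _ hsc hr (hx i)
          (fun k hk => by simpa [addJob, hij.symm] using hu k (Finset.sdiff_subset hk))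
          (fun k hk => by simpa [addJob, hij.symm, hk] using hu' k (hrb hk))
          (fun k hk => by
            simpa [addJob, (Finset.mem_sdiff.1 hk).2]
              using hv k (Finset.sdiff_subset hk))
          (fun k hk => by simpa [addJob, hij] using hv' k (hrb hk)) hvi
      exact ⟨u', v', hR', h1, i', k', L, by omega, hL'⟩
    obtain ⟨k, hk⟩ := Finset.card_pos.1 (by rw [hs]; positivity : 0 < s.card)
    refine ⟨_, _, hx i, hvi, x, k, g + h + (t + 1), by omega, ?_⟩
    simp [addJob, hxi, hxj]

lemma log_le_two_mul_of_lt_two_pow {n L : ℕ} (hn : 2 ≤ n) (h : n < 2 ^ (L + 1)) :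
    Real.log n ≤ 2 * L := by
  have hL : 1 ≤ L := by
    by_contra hL
    obtain rfl : L = 0 := by omega
    simp at h
    omega
  have h1 : Real.log n ≤ Real.log ((2 : ℝ) ^ (L + 1)) :=
    Real.log_le_log (by positivity) (by exact_mod_cast h.le)
  rw [Real.log_pow] at h1
  have h2 := Real.log_two_lt_d9
  have h3 : (1 : ℝ) ≤ L := by exact_mod_cast hL
  push_cast at h1
  nlinarith

lemma Reachable.exists_seq {m d : ℕ} {A : List (Fin m → Fin d → ℝ≥0∞) → Fin m}
    {u v : Fin m → Fin d → ℝ≥0∞} (hR : Reachable A u v) (hv : ∀ i k, v i k ≤ 1)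
    {i : Fin m} {k : Fin d} {L : ℕ} (hL : (L : ℝ≥0∞) ≤ u i k) {c : ℝ} (hc : c ≤ L) :
    ∃ σ : List (Fin m → Fin d → ℝ≥0∞),
      (∃ f : Fin σ.length → Fin m, ∀ i k, unrelLoad σ f i k ≤ 1) ∧
      (∃ i k, ENNReal.ofReal c ≤ unrelLoad σ (unrelOnline A σ) i k) := by
  obtain ⟨σ, f, rfl, rfl⟩ := hR
  refine ⟨σ, ⟨f, hv⟩, i, k, le_trans ?_ hL⟩
  rw [← ENNReal.ofReal_natCast]
  exact ENNReal.ofReal_le_ofReal hc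

/-- Lower bound of `Ω(log m + log d)` for online vector scheduling on unrelated
machines (VSMAX-U): there is `c > 0` such that for all sufficiently large `m`
and `d`, every deterministic online algorithm `A` admits a job sequence `σ`
for which some offline assignment has load at most `1` on every machine in
every dimension, while `A`'s assignment has some machine with load at least
`c · (log m + log d)` in some dimension. -/
theorem vsmaxU_lowerBound :
    ∃ c : ℝ, 0 < c ∧ ∃ M D : ℕ, ∀ m d : ℕ, M ≤ m → D ≤ d →
      ∀ A : List (Fin m → Fin d → ℝ≥0∞) → Fin m,
        ∃ σ : List (Fin m → Fin d → ℝ≥0∞),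
          (∃ f : Fin σ.length → Fin m, ∀ i k, unrelLoad σ f i k ≤ 1) ∧
          (∃ i k, ENNReal.ofReal (c * (Real.log m + Real.log d)) ≤
            unrelLoad σ (unrelOnline A σ) i k) := by
  refine ⟨1 / 8, by norm_num, 2, 2, fun m d hm hd A => ?_⟩
  rcases le_total (Real.log m) (Real.log d) with hle | hle
  · have hpow : 2 ^ Nat.log 2 d ≤ (Finset.univ : Finset (Fin d)).card := by
      simpa using Nat.pow_log_le_self 2 (by omega : d ≠ 0)
    obtain ⟨a, -, ha⟩ := Finset.exists_subset_card_eq hpow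
    have hij : (⟨0, by omega⟩ : Fin m) ≠ ⟨1, by omega⟩ := by simp
    obtain ⟨u, v, hR, hv, i, k, L, hL, hL'⟩ :=
      exists_large_load_of_dims hij (Nat.log 2 d) a a 0 0 0 0 ha ha (reachable_zero A)
        (by simp) (by simp) (by simp) (by simp) (by simp)
    have hlog := log_le_two_mul_of_lt_two_pow hd (Nat.lt_pow_succ_log_self one_lt_two d)
    have hL2 : (Nat.log 2 d : ℝ) ≤ 2 * L := by exact_mod_cast (by omega : Nat.log 2 d ≤ 2 * L)
    exact hR.exists_seq hv hL' (by linarith)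
  · obtain ⟨u, v, hR, hv, i, k, L, hL, hL'⟩ :=
      exists_large_load_of_machines (A := A) ⟨0, by omega⟩ (by omega : 0 < m) m Finset.univ 0 0 0
        (by simp) (reachable_zero A) (by simp) (by simp) (by simp) (by simp)
    have hlog := log_le_two_mul_of_lt_two_pow hm hL
    have hL0 : (0 : ℝ) ≤ L := L.cast_nonneg
    exact hR.exists_seq hv hL' (by linarith)
end

section
/- There is a constant c > 0 such that for every real r ≥ 1 and all sufficiently large integers m and d, for every deterministic online algorithm A for vector scheduling on m unrelated machines with d dimensions where the objective in every dimension is the L_r norm, there exists a finite job sequence σ such that some assignment g of σ satisfies ‖Λ^g(k)‖_r ≤ 1 for every dimension k ∈ [d], yet the assignment produced by A on σ satisfies ‖Λ^A(k)‖_r ≥ c · (r + log d) for some dimension k ∈ [d]. -/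
/-- Unrelated machines: load of machine `i` in dimension `k` when the jobs of `σ`
(each an `m × d` matrix of nonnegative loads, `p j i k` being the load job `j`
places on machine `i` in dimension `k`) are assigned via `f`. -/
def uLoad {m d : ℕ} (σ : List (Fin m → Fin d → NNReal))
    (f : Fin σ.length → Fin m) (i : Fin m) (k : Fin d) : NNReal :=
  ∑ j : Fin σ.length, if f j = i then σ.get j i k else 0

/-- The assignment produced by a deterministic online algorithm `A` on the job
sequence `σ`. -/
def uOnline {m d : ℕ} (A : List (Fin m → Fin d → NNReal) → Fin m)
    (σ : List (Fin m → Fin d → NNReal)) : Fin σ.length → Fin m :=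
  fun j => A (σ.take (j.1 + 1))

/-- The `L_r` norm `(∑ i, Λᶠᵢ(k)^r)^(1/r)` of the machine loads in dimension `k`
under the assignment `f`. -/
noncomputable def uNorm {m d : ℕ} (σ : List (Fin m → Fin d → NNReal))
    (f : Fin σ.length → Fin m) (k : Fin d) (r : ℝ) : ℝ :=
  (∑ i : Fin m, (uLoad σ f i k : ℝ) ^ r) ^ (1 / r)

open Finset in
theorem uLoad_append_singleton {m d : ℕ} (σ : List (Fin m → Fin d → NNReal))
    (p : Fin m → Fin d → NNReal) (f : Fin (σ ++ [p]).length → Fin m) (i : Fin m) (k : Fin d) :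
    uLoad (σ ++ [p]) f i k =
      uLoad σ (fun j => f ⟨j.1, by simp⟩) i k +
        if f ⟨σ.length, by simp⟩ = i then p i k else 0 := by
  have h : σ.length + 1 = (σ ++ [p]).length := by simp
  unfold uLoad
  rw [← (finCongr h).sum_comp, Fin.sum_univ_castSucc]
  congr 1
  · refine sum_congr rfl fun j _ => ?_
    have hj : (finCongr h) j.castSucc = ⟨j.1, by simp⟩ := rfl
    rw [hj]
    simp [List.getElem_append_left]
  · have hj : (finCongr h) (Fin.last σ.length) = ⟨σ.length, by simp⟩ := rfl
    rw [hj]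
    simp

theorem uLoad_uOnline_append_singleton {m d : ℕ}
    (A : List (Fin m → Fin d → NNReal) → Fin m) (σ : List (Fin m → Fin d → NNReal))
    (p : Fin m → Fin d → NNReal) (i : Fin m) (k : Fin d) :
    uLoad (σ ++ [p]) (uOnline A (σ ++ [p])) i k =
      uLoad σ (uOnline A σ) i k + if A (σ ++ [p]) = i then p i k else 0 := by
  rw [uLoad_append_singleton]
  congr 2
  · funext j
    have : j.1 + 1 ≤ σ.length := j.2
    simp only [uOnline]
    rw [List.take_append_of_le_length this]
  · rw [uOnline, List.take_of_length_le (by simp)]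

/-- An assignment of `σ` extends to `σ ++ [p]` by placing the new job on any machine. -/
theorem exists_extend_assignment {m d : ℕ} (σ : List (Fin m → Fin d → NNReal))
    (p : Fin m → Fin d → NNReal) (g : Fin σ.length → Fin m) (a : Fin m) :
    ∃ g' : Fin (σ ++ [p]).length → Fin m, ∀ k,
      ∑ i, uLoad (σ ++ [p]) g' i k = ∑ i, uLoad σ g i k + p a k := by
  refine ⟨fun j => if h : j.1 < σ.length then g ⟨j.1, h⟩ else a, fun k => ?_⟩
  simp [uLoad_append_singleton, Finset.sum_add_distrib]

theorem uNorm_le_one {m d : ℕ} {σ : List (Fin m → Fin d → NNReal)}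
    {f : Fin σ.length → Fin m} {k : Fin d} {r : ℝ} (hr : 1 ≤ r)
    (h : ∑ i, uLoad σ f i k ≤ 1) : uNorm σ f k r ≤ 1 := by
  have hr0 : 0 ≤ 1 / r := by positivity
  refine Real.rpow_le_one (by positivity) ?_ hr0
  have hi : ∀ i, uLoad σ f i k ≤ 1 := fun i =>
    (Finset.single_le_sum (f := fun i => uLoad σ f i k) (fun _ _ => zero_le)
      (Finset.mem_univ i)).trans h
  calc ∑ i, (uLoad σ f i k : ℝ) ^ r ≤ ∑ i, (uLoad σ f i k : ℝ) := by
        refine Finset.sum_le_sum fun i _ => ?_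
        simpa using Real.rpow_le_rpow_of_exponent_ge' (NNReal.coe_nonneg _)
          (by exact_mod_cast hi i) zero_le_one hr
    _ ≤ 1 := by exact_mod_cast h

theorem uLoad_le_uNorm {m d : ℕ} (σ : List (Fin m → Fin d → NNReal))
    (f : Fin σ.length → Fin m) (i : Fin m) (k : Fin d) {r : ℝ} (hr : 1 ≤ r) :
    (uLoad σ f i k : ℝ) ≤ uNorm σ f k r := by
  have hr0 : 0 ≤ 1 / r := by positivity
  calc (uLoad σ f i k : ℝ) = ((uLoad σ f i k : ℝ) ^ r) ^ (1 / r) := by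
        rw [one_div, Real.rpow_rpow_inv (NNReal.coe_nonneg _) (by linarith)]
    _ ≤ uNorm σ f k r := by
        refine Real.rpow_le_rpow (by positivity) ?_ hr0
        exact Finset.single_le_sum (f := fun i => (uLoad σ f i k : ℝ) ^ r)
          (fun _ _ => by positivity) (Finset.mem_univ i)

/-- The adversary job: unit load on the dimensions of `L` on machine `z`, unit load on the
dimensions of `R` on machine `o`, and load `B` in every dimension on all other machines. -/
noncomputable def splitJob {m d : ℕ} (z o : Fin m) (L R : Finset (Fin d)) (B : NNReal) :
    Fin m → Fin d → NNReal := fun i k =>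
  if i = z then (if k ∈ L then 1 else 0) else if i = o then (if k ∈ R then 1 else 0) else B

/-- Starting from an instance on which some offline assignment leaves the dimensions of `S`
unloaded while the online loads there are at least `t`, the adversary can repeatedly halve `S`
and continue with the half that the online algorithm loads. -/
theorem exists_adversary_sequence {m d : ℕ} (A : List (Fin m → Fin d → NNReal) → Fin m)
    {z o : Fin m} (hzo : z ≠ o) (B n : ℕ) :
    ∀ (t : ℕ) (σ : List (Fin m → Fin d → NNReal)) (S : Finset (Fin d)),
      t + n = B → 2 ^ n ≤ S.card →
      (∃ g : Fin σ.length → Fin m,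
        (∀ k, ∑ i, uLoad σ g i k ≤ 1) ∧ ∀ k ∈ S, ∑ i, uLoad σ g i k = 0) →
      (∀ k ∈ S, (t : NNReal) ≤ uLoad σ (uOnline A σ) z k + uLoad σ (uOnline A σ) o k) →
      ∃ σ : List (Fin m → Fin d → NNReal),
        (∃ g : Fin σ.length → Fin m, ∀ k, ∑ i, uLoad σ g i k ≤ 1) ∧
        ∃ i k, (B : NNReal) ≤ 2 * uLoad σ (uOnline A σ) i k := by
  induction n with
  | zero =>
    rintro t σ S rfl hS ⟨g, hg, -⟩ hA
    obtain ⟨k, hk⟩ : S.Nonempty := Finset.card_pos.mp (by simpa using hS)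
    refine ⟨σ, ⟨g, hg⟩, ?_⟩
    rcases le_total (uLoad σ (uOnline A σ) z k) (uLoad σ (uOnline A σ) o k) with h | h
    · exact ⟨o, k, (hA k hk).trans (by rw [two_mul]; gcongr)⟩
    · exact ⟨z, k, (hA k hk).trans (by rw [two_mul]; gcongr)⟩
  | succ n ih =>
    rintro t σ S hB hS ⟨g, hg, hg0⟩ hA
    have hpow : 2 ^ (n + 1) = 2 ^ n + 2 ^ n := by ring
    obtain ⟨L, hLS, hL⟩ := Finset.exists_subset_card_eq (s := S) (n := 2 ^ n) (by omega)
    have hR : 2 ^ n ≤ (S \ L).card := by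
      rw [Finset.card_sdiff_of_subset hLS]; omega
    set p := splitJob z o L (S \ L) (B : NNReal) with hp
    have hpz : ∀ k, p z k = if k ∈ L then 1 else 0 := fun k => by simp [hp, splitJob]
    have hpo : ∀ k, p o k = if k ∈ S \ L then 1 else 0 := fun k => by
      simp [hp, splitJob, hzo.symm]
    have hoff : ∀ a, (∀ k, p a k ≤ 1) → (∀ k ∉ S, p a k = 0) →
        ∃ g' : Fin (σ ++ [p]).length → Fin m, (∀ k, ∑ i, uLoad (σ ++ [p]) g' i k ≤ 1) ∧
          ∀ k ∈ S, ∑ i, uLoad (σ ++ [p]) g' i k = p a k := by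
      intro a ha1 ha0
      obtain ⟨g', hg'⟩ := exists_extend_assignment σ p g a
      refine ⟨g', fun k => ?_, fun k hk => by rw [hg', hg0 k hk, zero_add]⟩
      rw [hg']
      by_cases hk : k ∈ S
      · rw [hg0 k hk, zero_add]; exact ha1 k
      · rw [ha0 k hk, add_zero]; exact hg k
    have hz := hoff z (fun k => by rw [hpz]; split_ifs <;> simp)
      (fun k hk => by rw [hpz, if_neg fun h => hk (hLS h)])
    have ho := hoff o (fun k => by rw [hpo]; split_ifs <;> simp)
      (fun k hk => by rw [hpo, if_neg fun h => hk (Finset.mem_sdiff.mp h).1])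
    by_cases haz : A (σ ++ [p]) = z
    · obtain ⟨g', h1, h2⟩ := ho
      refine ih (t + 1) (σ ++ [p]) L (by omega) hL.ge ⟨g', h1, fun k hk => ?_⟩ fun k hk => ?_
      · rw [h2 k (hLS hk), hpo, if_neg fun h => (Finset.mem_sdiff.mp h).2 hk]
      · rw [uLoad_uOnline_append_singleton, uLoad_uOnline_append_singleton, haz, if_pos rfl,
          if_neg hzo, hpz, if_pos hk, add_zero, add_right_comm]
        push_cast
        gcongr
        exact hA k (hLS hk)
    by_cases hao : A (σ ++ [p]) = o
    · obtain ⟨g', h1, h2⟩ := hz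
      refine ih (t + 1) (σ ++ [p]) (S \ L) (by omega) hR ⟨g', h1, fun k hk => ?_⟩
        fun k hk => ?_
      · rw [h2 k (Finset.mem_sdiff.mp hk).1, hpz, if_neg (Finset.mem_sdiff.mp hk).2]
      · rw [uLoad_uOnline_append_singleton, uLoad_uOnline_append_singleton, hao, if_pos rfl,
          if_neg hzo.symm, hpo, if_pos hk, add_zero, ← add_assoc]
        push_cast
        gcongr
        exact hA k (Finset.mem_sdiff.mp hk).1
    · obtain ⟨g', h1, -⟩ := hz
      obtain ⟨k, hk⟩ : S.Nonempty := Finset.card_pos.mp (lt_of_lt_of_le (by positivity) hS)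
      refine ⟨σ ++ [p], ⟨g', h1⟩, A (σ ++ [p]), k, ?_⟩
      have hpa : p (A (σ ++ [p])) k = B := by
        conv_lhs => rw [hp]
        simp only [splitJob]
        rw [if_neg haz, if_neg hao]
      rw [uLoad_uOnline_append_singleton, if_pos rfl, hpa, two_mul]
      exact le_add_left le_add_self

/-- Lower bound of `Ω(r + log d)` for online vector scheduling on unrelated
machines with the `L_r` norm objective in every dimension: there is `c > 0`
such that for every `r ≥ 1` and all sufficiently large `m` and `d`, every
deterministic online algorithm `A` admits a job sequence `σ` for which some
offline assignment has `L_r` norm at most `1` in every dimension, while `A`'s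
assignment has `L_r` norm at least `c · (r + log d)` in some dimension. -/
theorem vsanyU_lowerBound :
    ∃ c : ℝ, 0 < c ∧ ∀ r : ℝ, 1 ≤ r →
      ∃ M D : ℕ, ∀ m d : ℕ, M ≤ m → D ≤ d →
        ∀ A : List (Fin m → Fin d → NNReal) → Fin m,
          ∃ σ : List (Fin m → Fin d → NNReal),
            (∃ g : Fin σ.length → Fin m, ∀ k, uNorm σ g k r ≤ 1) ∧
            (∃ k, c * (r + Real.log d) ≤ uNorm σ (uOnline A σ) k r) := by
  refine ⟨1 / 8, by norm_num, fun r hr => ⟨2, max 2 ⌈Real.exp r⌉₊, fun m d hm hd A => ?_⟩⟩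
  have hd2 : 2 ≤ d := (le_max_left _ _).trans hd
  have hrd : r ≤ Real.log d := by
    rw [Real.le_log_iff_exp_le (by positivity)]
    exact (Nat.le_ceil _).trans (by exact_mod_cast (le_max_right _ _).trans hd)
  have hT : Real.log d ≤ 2 * (Nat.log 2 d : ℝ) := by
    have h1 : (1 : ℝ) ≤ Nat.log 2 d := by exact_mod_cast Nat.log_pos one_lt_two hd2
    have h2 : (d : ℝ) ≤ 2 ^ (Nat.log 2 d + 1) := by
      exact_mod_cast (Nat.lt_pow_succ_log_self one_lt_two d).le
    have h3 := Real.log_le_log (by positivity) h2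
    rw [Real.log_pow] at h3
    push_cast at h3
    nlinarith [Real.log_two_lt_d9]
  have hzo : (⟨0, by omega⟩ : Fin m) ≠ ⟨1, by omega⟩ := by simp
  obtain ⟨σ, ⟨g, hg⟩, i, k, hik⟩ :=
    exists_adversary_sequence A hzo (Nat.log 2 d) (Nat.log 2 d) 0 [] Finset.univ (by simp)
      (by simpa using Nat.pow_log_le_self 2 (by omega))
      ⟨fun j => j.elim0, by simp [uLoad], by simp [uLoad]⟩ (by simp)
  refine ⟨σ, ⟨g, fun k => uNorm_le_one hr (hg k)⟩, k, ?_⟩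
  have h := uLoad_le_uNorm σ (uOnline A σ) i k hr
  have hik' : (Nat.log 2 d : ℝ) ≤ 2 * uLoad σ (uOnline A σ) i k := by exact_mod_cast hik
  linarith
end
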